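/- arXiv:1910.06942 — 2 statements merged into one kernel-verified Lean document; each statement's English description precedes it below -/
import Mathlib

section
/- Let N be a positive integer, k an even integer, and f : ℍ → ℂ a function transforming like a modular form of weight k for Γ₀(N). Let Q be an exact divisor of N and m a positive integer with gcd(m, Q) = 1 (so that Q is also an exact divisor of Nm). Let W_Q^{(N)} be any Atkin-Lehner matrix for Q at level N and W_Q^{(Nm)} any Atkin-Lehner matrix for Q at level Nm. Then (f∣ₖW_Q^{(N)})∣ₖB_m = (f∣ₖB_m)∣ₖW_Q^{(Nm)}. -/
noncomputable section

open Complex Matrix Finset UpperHalfPlane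

/-- Möbius action of a real `2×2` matrix on the upper half-plane (this is the genuine
Möbius action `τ ↦ (aτ+b)/(cτ+d)` whenever the matrix has positive determinant). -/
def moebius (g : Matrix (Fin 2) (Fin 2) ℝ) (τ : UpperHalfPlane) : UpperHalfPlane :=
  if h : 0 < ((((g 0 0 : ℝ) : ℂ) * (τ : ℂ) + ((g 0 1 : ℝ) : ℂ)) /
      (((g 1 0 : ℝ) : ℂ) * (τ : ℂ) + ((g 1 1 : ℝ) : ℂ))).im then
    UpperHalfPlane.mk _ h else τ

/-- The weight-`k` slash action of a real `2×2` matrix, normalized with `det ^ (k/2)`. -/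
def slash (k : ℤ) (g : Matrix (Fin 2) (Fin 2) ℝ) (f : UpperHalfPlane → ℂ) :
    UpperHalfPlane → ℂ :=
  fun τ => ((g.det : ℝ) : ℂ) ^ ((k : ℂ) / 2) *
    (((g 1 0 : ℝ) : ℂ) * (τ : ℂ) + ((g 1 1 : ℝ) : ℂ)) ^ (-k) * f (moebius g τ)

/-- `g` is (the image in `SL₂(ℝ)` of) an integer matrix of determinant `1` whose
lower-left entry is divisible by `N`, i.e. an element of `Γ₀(N)`. -/
def MemGamma0 (N : ℕ) (g : Matrix (Fin 2) (Fin 2) ℝ) : Prop :=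
  (∃ a b c d : ℤ, g = !![(a : ℝ), (b : ℝ); (c : ℝ), (d : ℝ)] ∧ (N : ℤ) ∣ c) ∧ g.det = 1

/-- `f` transforms like a modular form of weight `k` for `Γ₀(N)`. -/
def TransformsLike (N : ℕ) (k : ℤ) (f : UpperHalfPlane → ℂ) : Prop :=
  ∀ g, MemGamma0 N g → slash k g f = f

/-- An Atkin-Lehner matrix for the exact divisor `Q` at level `N`:
`W_Q = (1/√Q)·(Qx, y; Nz, Qt)` with integer entries and determinant `1`. -/
def IsAtkinLehner (N Q : ℕ) (W : Matrix (Fin 2) (Fin 2) ℝ) : Prop :=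
  (∃ x y z t : ℤ,
      W = (Real.sqrt Q)⁻¹ • !![(Q : ℝ) * x, (y : ℝ); (N : ℝ) * z, (Q : ℝ) * t]) ∧
    W.det = 1

/-- The matrix `B_m = (1/√m)·(m, 0; 0, 1)`. -/
def Bmat (m : ℕ) : Matrix (Fin 2) (Fin 2) ℝ :=
  (Real.sqrt m)⁻¹ • !![(m : ℝ), 0; 0, 1]

/-- The `m`-th Hecke operator of weight `k` and level `N`:
`(f∣T_m)(τ) = m^{k/2−1} Σ_{ad = m, gcd(a,N)=1} Σ_{b=0}^{d−1} (f∣ₖ(a, b; 0, d))(τ)`. -/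
def hecke (N : ℕ) (k : ℤ) (m : ℕ) (f : UpperHalfPlane → ℂ) : UpperHalfPlane → ℂ :=
  fun τ => (m : ℂ) ^ ((k : ℂ) / 2 - 1) *
    ∑ a ∈ m.divisors, if Nat.gcd a N = 1 then
      ∑ b ∈ Finset.range (m / a), slash k !![(a : ℝ), (b : ℝ); 0, ((m / a : ℕ) : ℝ)] f τ
    else 0

/-- The weight-`0` operator `U_m`: `(f∣U_m)(τ) = (1/m) Σ_{j=0}^{m−1} f((τ+j)/m)`. -/
def U0 (m : ℕ) (f : UpperHalfPlane → ℂ) : UpperHalfPlane → ℂ :=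
  fun τ => (1 / (m : ℂ)) * ∑ j ∈ Finset.range m, f (moebius !![1, (j : ℝ); 0, (m : ℝ)] τ)

/-- The weight-`0` operator `B_m`: `(f∣B_m)(τ) = f(mτ)`. -/
def B0 (m : ℕ) (f : UpperHalfPlane → ℂ) : UpperHalfPlane → ℂ :=
  fun τ => f (moebius !![(m : ℝ), 0; 0, 1] τ)

/-- The weight-`0` action of a matrix: `(f∣W)(τ) = f(W·τ)`. -/
def W0 (W : Matrix (Fin 2) (Fin 2) ℝ) (f : UpperHalfPlane → ℂ) : UpperHalfPlane → ℂ :=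
  fun τ => f (moebius W τ)

/-- `f` is invariant under `Γ₀(N)` in weight `0`. -/
def Inv0 (N : ℕ) (f : UpperHalfPlane → ℂ) : Prop :=
  ∀ g, MemGamma0 N g → ∀ τ, f (moebius g τ) = f τ

/-- The automorphy factor of a real matrix of determinant one does not vanish on `ℍ`. -/
theorem denom_ne_zero_of_det_eq_one {g : Matrix (Fin 2) (Fin 2) ℝ} (hg : g.det = 1)
    (τ : UpperHalfPlane) :
    ((g 1 0 : ℝ) : ℂ) * (τ : ℂ) + ((g 1 1 : ℝ) : ℂ) ≠ 0 := by
  intro h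
  rw [Matrix.det_fin_two] at hg
  have hre := congrArg Complex.re h
  have him := congrArg Complex.im h
  simp at hre him
  rcases him with h0 | h0
  · rw [h0] at hre hg
    simp at hre
    simp [hre] at hg
  · exact τ.im_pos.ne' h0

/-- For determinant one, `moebius` is the usual fractional linear map. -/
theorem coe_moebius {g : Matrix (Fin 2) (Fin 2) ℝ} (hg : g.det = 1) (τ : UpperHalfPlane) :
    (moebius g τ : ℂ) = (((g 0 0 : ℝ) : ℂ) * (τ : ℂ) + ((g 0 1 : ℝ) : ℂ)) /
      (((g 1 0 : ℝ) : ℂ) * (τ : ℂ) + ((g 1 1 : ℝ) : ℂ)) := by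
  have hd := denom_ne_zero_of_det_eq_one hg τ
  have hpos : 0 < ((((g 0 0 : ℝ) : ℂ) * (τ : ℂ) + ((g 0 1 : ℝ) : ℂ)) /
      (((g 1 0 : ℝ) : ℂ) * (τ : ℂ) + ((g 1 1 : ℝ) : ℂ))).im := by
    rw [Complex.div_im, ← sub_div]
    apply div_pos _ (Complex.normSq_pos.mpr hd)
    rw [Matrix.det_fin_two] at hg
    have him : 0 < (τ : ℂ).im := τ.im_pos
    simp only [Complex.add_im, Complex.add_re, Complex.mul_im, Complex.mul_re,
      Complex.ofReal_re, Complex.ofReal_im]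
    refine him.trans_eq ?_
    linear_combination -(τ : ℂ).im * hg
  rw [moebius, dif_pos hpos]

theorem moebius_mul {g h : Matrix (Fin 2) (Fin 2) ℝ} (hg : g.det = 1) (hh : h.det = 1)
    (τ : UpperHalfPlane) : moebius (g * h) τ = moebius g (moebius h τ) := by
  have hgh : (g * h).det = 1 := by rw [Matrix.det_mul, hg, hh, one_mul]
  have h1 := denom_ne_zero_of_det_eq_one hh τ
  have h2 := denom_ne_zero_of_det_eq_one hg (moebius h τ)
  have h3 := denom_ne_zero_of_det_eq_one hgh τ
  apply UpperHalfPlane.ext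
  rw [coe_moebius hg] at *
  rw [coe_moebius hgh]
  rw [coe_moebius hh] at *
  rw [div_eq_div_iff h3 h2]
  simp only [Matrix.mul_apply, Fin.sum_univ_two]
  push_cast
  field_simp
  ring

/-- The slash action is a right action of real matrices of determinant one. -/
theorem slash_slash (k : ℤ) {g h : Matrix (Fin 2) (Fin 2) ℝ} (hg : g.det = 1)
    (hh : h.det = 1) (f : UpperHalfPlane → ℂ) :
    slash k h (slash k g f) = slash k (g * h) f := by
  have hgh : (g * h).det = 1 := by rw [Matrix.det_mul, hg, hh, one_mul]
  funext τ
  have h1 := denom_ne_zero_of_det_eq_one hh τ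
  simp only [slash, hg, hh, hgh, Complex.ofReal_one, Complex.one_cpow, one_mul,
    moebius_mul hg hh τ]
  rw [← mul_assoc, ← mul_zpow, coe_moebius hh]
  congr 2
  simp only [Matrix.mul_apply, Fin.sum_univ_two]
  push_cast
  field_simp
  ring

theorem det_Bmat {m : ℕ} (hm : 0 < m) : (Bmat m).det = 1 := by
  have hm' : (0 : ℝ) < m := Nat.cast_pos.mpr hm
  have hs : Real.sqrt m ^ 2 = m := Real.sq_sqrt hm'.le
  have h0 : Real.sqrt m ≠ 0 := (Real.sqrt_pos.mpr hm').ne'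
  simp [Bmat, Matrix.det_fin_two]
  field_simp
  linarith

/-- Conjugating an Atkin-Lehner matrix at level `N * m` by `B_m` gives one at level `N`. -/
theorem IsAtkinLehner.exists_Bmat_mul {N Q m : ℕ}
    {W : Matrix (Fin 2) (Fin 2) ℝ} (hW : IsAtkinLehner (N * m) Q W) :
    ∃ V, IsAtkinLehner N Q V ∧ Bmat m * W = V * Bmat m := by
  obtain ⟨⟨x, y, z, t, rfl⟩, hdet⟩ := hW
  refine ⟨(Real.sqrt Q)⁻¹ • !![(Q : ℝ) * x, ((m * y : ℤ) : ℝ); (N : ℝ) * z, (Q : ℝ) * t],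
    ⟨⟨x, m * y, z, t, rfl⟩, ?_⟩, ?_⟩
  · rw [← hdet]
    simp [Matrix.det_fin_two]
    ring
  · ext i j
    fin_cases i <;> fin_cases j <;> simp [Bmat, Matrix.mul_apply, Fin.sum_univ_two] <;> ring

/-- Two Atkin-Lehner matrices for the same `Q` differ by an element of `Γ₀(N)`. -/
theorem IsAtkinLehner.exists_eq_mul {N Q : ℕ} (hN : 0 < N) (hQ : Q ∣ N)
    {V W : Matrix (Fin 2) (Fin 2) ℝ} (hV : IsAtkinLehner N Q V) (hW : IsAtkinLehner N Q W) :
    ∃ g, MemGamma0 N g ∧ V = g * W := by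
  obtain ⟨M, rfl⟩ := hQ
  have hQ0 : 0 < Q := Nat.pos_of_mul_pos_right hN
  have hW' : IsUnit W.det := by rw [hW.2]; exact isUnit_one
  refine ⟨V * W.adjugate, ⟨?_, ?_⟩, ?_⟩
  · obtain ⟨⟨x, y, z, t, rfl⟩, -⟩ := hW
    obtain ⟨⟨x', y', z', t', rfl⟩, -⟩ := hV
    refine ⟨Q * x' * t - M * y' * z, x * y' - x' * y, Q * M * (z' * t - z * t'),
      Q * x * t' - M * z' * y, ?_, ⟨z' * t - z * t', by push_cast; ring⟩⟩
    have hQR : (0 : ℝ) < Q := Nat.cast_pos.mpr hQ0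
    have hs : Real.sqrt Q ^ 2 = Q := Real.sq_sqrt hQR.le
    have h0 : Real.sqrt Q ≠ 0 := (Real.sqrt_pos.mpr hQR).ne'
    ext i j
    fin_cases i <;> fin_cases j <;>
      simp [Matrix.adjugate_fin_two, Matrix.mul_apply, Fin.sum_univ_two] <;>
      field_simp <;> rw [hs] <;> ring
  · rw [Matrix.det_mul, Matrix.det_adjugate, hV.2, hW.2]
    simp
  · rw [Matrix.mul_assoc, Matrix.adjugate_mul, hW.2, one_smul, Matrix.mul_one]

/-- For an exact divisor `Q` of `N`, a positive integer `m` coprime to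
`Q`, and `f` transforming like a modular form of even weight `k` for `Γ₀(N)`, one has
`(f∣ₖW_Q^{(N)})∣ₖB_m = (f∣ₖB_m)∣ₖW_Q^{(Nm)}`. -/
theorem atkinLehner_Bm_comm (N : ℕ) (hN : 0 < N) (k : ℤ) (hk : Even k)
    (f : UpperHalfPlane → ℂ) (hf : TransformsLike N k f)
    (Q : ℕ) (hQ : Q ∣ N) (hQe : Nat.gcd Q (N / Q) = 1)
    (m : ℕ) (hm : 0 < m) (hmQ : Nat.gcd m Q = 1)
    (W : Matrix (Fin 2) (Fin 2) ℝ) (hW : IsAtkinLehner N Q W)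
    (W' : Matrix (Fin 2) (Fin 2) ℝ) (hW' : IsAtkinLehner (N * m) Q W') :
    slash k (Bmat m) (slash k W f) = slash k W' (slash k (Bmat m) f) := by
  obtain ⟨V, hV, hBV⟩ := hW'.exists_Bmat_mul
  obtain ⟨g, hg, rfl⟩ := hV.exists_eq_mul hN hQ hW
  have hB := det_Bmat hm
  rw [slash_slash k hB hW'.2, hBV, ← slash_slash k hV.2 hB, ← slash_slash k hg.2 hW.2, hf g hg]
end
end

section
/- Let N be a positive integer, p a prime exactly dividing N (p ∣ N, p ∤ N/p), and f : ℍ → ℂ a function invariant under Γ₀(N) in weight 0 (i.e. f(γ·τ) = f(τ) for all γ ∈ Γ₀(N)). For m ≥ 1 define (g∣U_m)(τ) = (1/m) Σ_{j=0}^{m−1} g((τ+j)/m) and (g∣B_m)(τ) = g(mτ), and for an Atkin-Lehner matrix W_p for p at level N define (g∣W_p)(τ) = g(W_p·τ). Then for every integer r ≥ 1: f∣U_{p^r}∣W_p = f∣U_{p^r}∣B_p + (1/p)·f∣U_{p^{r−1}}∣W_p∣B_p − (1/p)·f∣U_{p^{r−1}}. -/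
noncomputable section

open Complex Matrix Finset UpperHalfPlane

theorem coe_moebius_of_det_pos {g : Matrix (Fin 2) (Fin 2) ℝ} (hg : 0 < g.det)
    (τ : UpperHalfPlane) :
    (moebius g τ : ℂ) = (((g 0 0 : ℝ) : ℂ) * (τ : ℂ) + ((g 0 1 : ℝ) : ℂ)) /
      (((g 1 0 : ℝ) : ℂ) * (τ : ℂ) + ((g 1 1 : ℝ) : ℂ)) := by
  have h := UpperHalfPlane.coe_smul_of_det_pos
    (g := Matrix.GeneralLinearGroup.mkOfDetNeZero g hg.ne') hg τ
  have him : 0 < ((((g 0 0 : ℝ) : ℂ) * (τ : ℂ) + ((g 0 1 : ℝ) : ℂ)) /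
      (((g 1 0 : ℝ) : ℂ) * (τ : ℂ) + ((g 1 1 : ℝ) : ℂ))).im := by
    have h' := (Matrix.GeneralLinearGroup.mkOfDetNeZero g hg.ne' • τ).im_pos
    rw [← UpperHalfPlane.coe_im, h] at h'
    exact h'
  rw [moebius, dif_pos him]

theorem coe_moebius_translate_div {m : ℕ} (hm : 0 < m) (j : ℕ) (τ : UpperHalfPlane) :
    (moebius !![1, (j : ℝ); 0, (m : ℝ)] τ : ℂ) = ((τ : ℂ) + j) / m := by
  rw [coe_moebius_of_det_pos (by simpa [Matrix.det_fin_two_of] using hm)]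
  simp

theorem coe_moebius_mul {m : ℕ} (hm : 0 < m) (τ : UpperHalfPlane) :
    (moebius !![(m : ℝ), 0; 0, 1] τ : ℂ) = m * (τ : ℂ) := by
  rw [coe_moebius_of_det_pos (by simpa [Matrix.det_fin_two_of] using hm)]
  simp

/-- An Atkin-Lehner matrix for `p` at level `p * M` comes from an integer matrix
`(p x, y; p M z, p t)` of determinant `p`, through which it acts on `ℍ`. -/
theorem IsAtkinLehner.exists_entries {p M : ℕ} (hp : 0 < p)
    {W : Matrix (Fin 2) (Fin 2) ℝ} (hW : IsAtkinLehner (p * M) p W) :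
    ∃ x y z t : ℤ, p * x * t - M * y * z = 1 ∧ ∀ τ : UpperHalfPlane,
      (p * (M * z * (τ : ℂ) + t) : ℂ) ≠ 0 ∧
      (moebius W τ : ℂ) = (p * x * (τ : ℂ) + y) / (p * (M * z * (τ : ℂ) + t)) := by
  obtain ⟨⟨x, y, z, t, rfl⟩, hdet⟩ := hW
  have hp0 : (0 : ℝ) < p := by exact_mod_cast hp
  have hs : (Real.sqrt p)⁻¹ ≠ 0 := inv_ne_zero (Real.sqrt_pos.2 hp0).ne'
  have hD : (p * x * t - M * y * z : ℤ) = 1 := by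
    have h := hdet
    rw [Matrix.det_smul, Matrix.det_fin_two_of, Fintype.card_fin, inv_pow,
      Real.sq_sqrt hp0.le] at h
    push_cast at h
    have h' : (p * x * t - M * y * z : ℝ) = 1 := by
      rw [← h]; field_simp
    exact_mod_cast h'
  refine ⟨x, y, z, t, hD, fun τ => ⟨mul_ne_zero (by exact_mod_cast hp.ne') ?_, ?_⟩⟩
  · have h := UpperHalfPlane.linear_ne_zero (cd := ![(M * z : ℝ), (t : ℝ)]) τ (by
      intro h0
      have h1 : (M * z : ℝ) = 0 := congrFun h0 0
      have h2 : (t : ℝ) = 0 := congrFun h0 1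
      have h1' : (M * z : ℤ) = 0 := by exact_mod_cast h1
      have h2' : t = 0 := by exact_mod_cast h2
      rw [h2'] at hD
      have : (0 : ℤ) = 1 := by linear_combination hD + y * h1'
      exact zero_ne_one this)
    simpa using h
  · rw [coe_moebius_of_det_pos (by rw [hdet]; exact one_pos)]
    have hs' : (((Real.sqrt p)⁻¹ : ℝ) : ℂ) ≠ 0 := by exact_mod_cast hs
    rw [← mul_div_mul_left (p * x * (τ : ℂ) + y) _ hs']
    congr 1 <;> simp <;> ring

/-- `Γ₀(N)`-invariance, with both points written as fractions. -/
theorem Inv0.apply_eq {N : ℕ} {f : UpperHalfPlane → ℂ} (hf : Inv0 N f)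
    {τ₁ τ₂ : UpperHalfPlane} {n₁ d₁ n₂ d₂ : ℂ} (h₁ : (τ₁ : ℂ) = n₁ / d₁)
    (h₂ : (τ₂ : ℂ) = n₂ / d₂) (hd₂ : d₂ ≠ 0) {a b c d : ℤ} (hdet : a * d - b * c = 1)
    (hc : (N : ℤ) ∣ c) (hn : n₁ = a * n₂ + b * d₂) (hd : d₁ = c * n₂ + d * d₂) :
    f τ₁ = f τ₂ := by
  have hg : (!![(a : ℝ), (b : ℝ); (c : ℝ), (d : ℝ)]).det = 1 := by
    rw [Matrix.det_fin_two_of]; exact_mod_cast hdet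
  rw [← hf _ ⟨⟨a, b, c, d, rfl, hc⟩, hg⟩ τ₂]
  congr 1
  apply UpperHalfPlane.ext
  rw [coe_moebius_of_det_pos (by rw [hg]; exact one_pos), h₁, h₂, hn, hd]
  simp only [Matrix.of_apply, Matrix.cons_val', Matrix.cons_val_zero, Matrix.cons_val_one,
    Matrix.cons_val_fin_one, ofReal_intCast]
  rw [← mul_div_mul_right (a * (n₂ / d₂) + b) _ hd₂]
  congr 1 <;> field_simp

theorem Finset.sum_eq_sum_of_rel {α β R : Type*} [AddCommMonoid R] {s : Finset α}
    {t : Finset β} {f : α → R} {g : β → R} (r : α → β → Prop)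
    (hst : ∀ a ∈ s, ∃ b ∈ t, r a b) (hts : ∀ b ∈ t, ∃ a ∈ s, r a b)
    (hr : ∀ a ∈ s, ∀ b ∈ t, ∀ b' ∈ t, r a b → r a b' → b = b')
    (hl : ∀ b ∈ t, ∀ a ∈ s, ∀ a' ∈ s, r a b → r a' b → a = a')
    (hfg : ∀ a ∈ s, ∀ b ∈ t, r a b → f a = g b) : ∑ a ∈ s, f a = ∑ b ∈ t, g b := by
  choose i hi hri using hst
  refine Finset.sum_bij i hi ?_ ?_ fun a ha => hfg a ha _ (hi a ha) (hri a ha)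
  · intro a ha a' ha' h
    exact hl _ (hi a ha) _ ha _ ha' (hri a ha) (h ▸ hri a' ha')
  · intro b hb
    obtain ⟨a, ha, hab⟩ := hts b hb
    exact ⟨a, ha, hr a ha _ (hi a ha) _ hb (hri a ha) hab⟩

theorem Int.exists_mem_range_dvd_mul_add {m : ℕ} (hm : 0 < m) {u : ℤ}
    (hu : IsCoprime u (m : ℤ)) (v : ℤ) :
    ∃ j ∈ Finset.range m, (m : ℤ) ∣ u * (j : ℤ) + v := by
  obtain ⟨a, b, hab⟩ := hu
  have hm' : (m : ℤ) ≠ 0 := by exact_mod_cast hm.ne'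
  have h0 := Int.emod_nonneg (-(a * v)) hm'
  have h1 := Int.emod_lt_of_pos (-(a * v)) (by exact_mod_cast hm : (0 : ℤ) < m)
  have h2 := Int.emod_add_mul_ediv (-(a * v)) m
  refine ⟨(-(a * v) % m).toNat, ?_, ?_⟩
  · rw [Finset.mem_range]; omega
  · rw [Int.toNat_of_nonneg h0]
    exact ⟨b * v - u * (-(a * v) / m), by linear_combination u * h2 - v * hab⟩

theorem Int.eq_of_mem_range_of_dvd_mul_sub {m : ℕ} {u : ℤ} (hu : IsCoprime u (m : ℤ))
    {i j : ℕ} (hi : i ∈ Finset.range m) (hj : j ∈ Finset.range m)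
    (h : (m : ℤ) ∣ u * ((i : ℤ) - j)) : i = j := by
  rw [Finset.mem_range] at hi hj
  have h' := Int.eq_zero_of_abs_lt_dvd (hu.symm.dvd_of_dvd_mul_left h)
    (by rw [abs_lt]; omega)
  omega

theorem Nat.Prime.isCoprime_pow_of_not_dvd {p : ℕ} (hp : p.Prime) {u : ℤ} (h : ¬ (p : ℤ) ∣ u)
    (s : ℕ) : IsCoprime u ((p ^ s : ℕ) : ℤ) := by
  push_cast
  exact ((Nat.prime_iff_prime_int.1 hp).coprime_iff_not_dvd.2 h).symm.pow_right

section
variable {p M : ℕ} {x y z t : ℤ}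

theorem not_dvd_of_mul_sub_eq_one (hp : p.Prime) (hD : p * x * t - M * y * z = 1) :
    ¬ (p : ℤ) ∣ y ∧ ¬ (p : ℤ) ∣ M * z := by
  have h1 : ¬ (p : ℤ) ∣ 1 := (Nat.prime_iff_prime_int.1 hp).not_dvd_one
  refine ⟨fun ⟨k, hk⟩ => h1 ⟨x * t - M * k * z, ?_⟩, fun ⟨k, hk⟩ => h1 ⟨x * t - y * k, ?_⟩⟩
  · linear_combination -hD - M * z * hk
  · linear_combination -hD - y * hk

/-- The terms of `f ∣ U_{p^{s+1}} ∣ W_p` whose matrix has unit upper-left entry are the terms of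
`f ∣ U_{p^{s+1}} ∣ B_p` with index prime to `p`. -/
theorem sum_filter_not_dvd_eq (hp : p.Prime) (hD : p * x * t - M * y * z = 1)
    {f : UpperHalfPlane → ℂ} (hf : Inv0 (p * M) f) (s : ℕ) {τ w : UpperHalfPlane}
    (hw : (w : ℂ) = (p * x * (τ : ℂ) + y) / (p * (M * z * (τ : ℂ) + t)))
    (h0 : (p * (M * z * (τ : ℂ) + t) : ℂ) ≠ 0) :
    ∑ j ∈ range (p ^ (s + 1)) with ¬ ((p : ℤ) ∣ x + (j : ℕ) * (M * z)),
        f (moebius !![1, (j : ℝ); 0, ((p ^ (s + 1) : ℕ) : ℝ)] w) =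
      ∑ j ∈ range (p ^ (s + 1)) with ¬ ((p : ℤ) ∣ (j : ℕ)),
        f (moebius !![1, (j : ℝ); 0, ((p ^ (s + 1) : ℕ) : ℝ)]
          (moebius !![(p : ℝ), 0; 0, 1] τ)) := by
  have hpp : Prime (p : ℤ) := Nat.prime_iff_prime_int.1 hp
  obtain ⟨hy, hz⟩ := not_dvd_of_mul_sub_eq_one hp hD
  have hm : 0 < p ^ (s + 1) := pow_pos hp.pos _
  have hpm : (p : ℤ) ∣ ((p ^ (s + 1) : ℕ) : ℤ) := by
    push_cast; exact dvd_pow_self _ s.succ_ne_zero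
  have hcop : ∀ i : ℤ, ¬ (p : ℤ) ∣ i → ¬ (p : ℤ) ∣ M * z * i - p * t := fun i hi h =>
    (hpp.dvd_or_dvd ((dvd_sub_left (dvd_mul_right _ _)).1 h)).elim hz hi
  refine Finset.sum_eq_sum_of_rel (fun j i : ℕ => ((p ^ (s + 1) : ℕ) : ℤ) ∣
    (x + j * (M * z)) * i - (y + j * (p * t))) ?_ ?_ ?_ ?_ ?_
  · intro j hj
    rw [Finset.mem_filter] at hj
    obtain ⟨i, hi, h⟩ := Int.exists_mem_range_dvd_mul_add hm
      (hp.isCoprime_pow_of_not_dvd hj.2 (s + 1)) (-(y + j * (p * t)))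
    refine ⟨i, Finset.mem_filter.2 ⟨hi, fun hpi => hy ?_⟩, by simpa [sub_eq_add_neg] using h⟩
    obtain ⟨k, hk⟩ := hpm.trans h
    obtain ⟨l, hl⟩ := hpi
    exact ⟨(x + j * (M * z)) * l - j * t - k, by
      linear_combination (x + j * (M * z)) * hl - hk⟩
  · intro i hi
    rw [Finset.mem_filter] at hi
    obtain ⟨j, hj, h⟩ := Int.exists_mem_range_dvd_mul_add hm
      (hp.isCoprime_pow_of_not_dvd (hcop i hi.2) (s + 1)) (x * i - y)
    have h' : ((p ^ (s + 1) : ℕ) : ℤ) ∣ (x + j * (M * z)) * i - (y + j * (p * t)) := by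
      convert h using 1; ring
    refine ⟨j, Finset.mem_filter.2 ⟨hj, fun hpj => hy ?_⟩, h'⟩
    obtain ⟨k, hk⟩ := hpm.trans h'
    obtain ⟨l, hl⟩ := hpj
    exact ⟨l * i - j * t - k, by linear_combination i * hl - hk⟩
  · intro j hj i hi i' hi' h h'
    rw [Finset.mem_filter] at hj hi hi'
    refine Int.eq_of_mem_range_of_dvd_mul_sub (hp.isCoprime_pow_of_not_dvd hj.2 (s + 1))
      hi.1 hi'.1 ?_
    obtain ⟨k, hk⟩ := dvd_sub h h'
    exact ⟨k, by linear_combination hk⟩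
  · intro i hi j hj j' hj' h h'
    rw [Finset.mem_filter] at hi hj hj'
    refine Int.eq_of_mem_range_of_dvd_mul_sub
      (hp.isCoprime_pow_of_not_dvd (hcop i hi.2) (s + 1)) hj.1 hj'.1 ?_
    obtain ⟨k, hk⟩ := dvd_sub h h'
    exact ⟨k, by linear_combination hk⟩
  · rintro j - i - ⟨k, hk⟩
    have hm' : ((p ^ (s + 1) : ℕ) : ℂ) ≠ 0 := by exact_mod_cast hm.ne'
    refine hf.apply_eq (a := x + j * (M * z)) (b := -k) (c := p ^ (s + 1) * (M * z))
      (d := p * t - M * z * i)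
      (n₁ := p * x * (τ : ℂ) + y + j * (p * (M * z * (τ : ℂ) + t)))
      (d₁ := p ^ (s + 1) * (p * (M * z * (τ : ℂ) + t)))
      (n₂ := p * (τ : ℂ) + i) (d₂ := (p ^ (s + 1) : ℕ)) ?_
      (by rw [coe_moebius_translate_div hm, coe_moebius_mul hp.pos]) hm' ?_ ?_ ?_ ?_
    · rw [coe_moebius_translate_div hm, hw, div_add' _ _ _ h0, div_div,
        mul_comm (p * (M * z * (τ : ℂ) + t) : ℂ)]
      push_cast; rfl
    · push_cast at hk
      linear_combination hD - M * z * hk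
    · push_cast
      exact ⟨p ^ s * z, by ring⟩
    · have hk' := congrArg (Int.cast : ℤ → ℂ) hk
      push_cast at hk' ⊢
      linear_combination -hk'
    · push_cast; ring

/-- The terms of `f ∣ U_{p^{s+1}} ∣ W_p` whose matrix has upper-left entry divisible by `p` are the
terms of `f ∣ U_{p^s} ∣ W_p ∣ B_p`. -/
theorem sum_filter_dvd_eq (hp : p.Prime) (hD : p * x * t - M * y * z = 1)
    {f : UpperHalfPlane → ℂ} (hf : Inv0 (p * M) f) (s : ℕ) {τ w w' : UpperHalfPlane}
    (hw : (w : ℂ) = (p * x * (τ : ℂ) + y) / (p * (M * z * (τ : ℂ) + t)))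
    (h0 : (p * (M * z * (τ : ℂ) + t) : ℂ) ≠ 0)
    (hw' : (w' : ℂ) = (p * x * (p * (τ : ℂ)) + y) / (p * (M * z * (p * (τ : ℂ)) + t)))
    (h0' : (p * (M * z * (p * (τ : ℂ)) + t) : ℂ) ≠ 0) :
    ∑ j ∈ range (p ^ (s + 1)) with ((p : ℤ) ∣ x + (j : ℕ) * (M * z)),
        f (moebius !![1, (j : ℝ); 0, ((p ^ (s + 1) : ℕ) : ℝ)] w) =
      ∑ i ∈ range (p ^ s), f (moebius !![1, (i : ℝ); 0, ((p ^ s : ℕ) : ℝ)] w') := by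
  have hpp : Prime (p : ℤ) := Nat.prime_iff_prime_int.1 hp
  obtain ⟨hy, hz⟩ := not_dvd_of_mul_sub_eq_one hp hD
  have hm : 0 < p ^ (s + 1) := pow_pos hp.pos _
  have hms : 0 < p ^ s := pow_pos hp.pos _
  have hp0 : (p : ℤ) ≠ 0 := hpp.ne_zero
  have hpm : (p : ℤ) ∣ ((p ^ (s + 1) : ℕ) : ℤ) := by
    push_cast; exact dvd_pow_self _ s.succ_ne_zero
  have hyi : ∀ i : ℤ, ¬ (p : ℤ) ∣ y + i * (p * t) := fun i h =>
    hy ((dvd_add_left ⟨i * t, by ring⟩).1 h)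
  have hcop : ∀ i : ℤ, ¬ (p : ℤ) ∣
      p ^ 2 * t * (x + i * (M * z)) - M * z * (y + i * (p * t)) := fun i h =>
    (hpp.dvd_or_dvd ((dvd_sub_right ⟨p * t * (x + i * (M * z)), by ring⟩).1 h)).elim hz (hyi i)
  have hcop' : ∀ j u : ℤ, ¬ (p : ℤ) ∣ (y + j * (p * t)) * (M * z) - u * (p * t) := fun j u h =>
    (hpp.dvd_or_dvd ((dvd_sub_left ⟨u * t, by ring⟩).1 h)).elim (hyi j) hz
  refine Finset.sum_eq_sum_of_rel (fun j i : ℕ => ((p ^ (s + 1) : ℕ) : ℤ) ∣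
    p * (y + j * (p * t)) * (x + i * (M * z)) - (x + j * (M * z)) * (y + i * (p * t)))
    ?_ ?_ ?_ ?_ ?_
  · intro j hj
    obtain ⟨u, hu⟩ := (Finset.mem_filter.1 hj).2
    obtain ⟨i, hi, k, hk⟩ := Int.exists_mem_range_dvd_mul_add hms
      (hp.isCoprime_pow_of_not_dvd (hcop' j u) s) ((y + j * (p * t)) * x - u * y)
    refine ⟨i, hi, k, ?_⟩
    push_cast at hk ⊢
    linear_combination p * hk - (y + i * (p * t)) * hu
  · intro i hi
    obtain ⟨j, hj, h⟩ := Int.exists_mem_range_dvd_mul_add hm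
      (hp.isCoprime_pow_of_not_dvd (hcop i) (s + 1))
      (p * y * (x + i * (M * z)) - x * (y + i * (p * t)))
    have h' : ((p ^ (s + 1) : ℕ) : ℤ) ∣ p * (y + j * (p * t)) * (x + i * (M * z)) -
        (x + j * (M * z)) * (y + i * (p * t)) := by
      convert h using 1; ring
    refine ⟨j, Finset.mem_filter.2 ⟨hj, ?_⟩, h'⟩
    have h2 := (dvd_sub_right ⟨(y + j * (p * t)) * (x + i * (M * z)), by ring⟩).1 (hpm.trans h')
    exact (hpp.dvd_or_dvd h2).resolve_right (hyi i)
  · intro j hj i hi i' hi' h h'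
    obtain ⟨u, hu⟩ := (Finset.mem_filter.1 hj).2
    refine Int.eq_of_mem_range_of_dvd_mul_sub (hp.isCoprime_pow_of_not_dvd (hcop' j u) s)
      hi hi' ?_
    obtain ⟨k, hk⟩ := dvd_sub h h'
    refine ⟨k, mul_left_cancel₀ hp0 ?_⟩
    push_cast at hk ⊢
    linear_combination hk + (i - i') * (p * t) * hu
  · intro i hi j hj j' hj' h h'
    refine Int.eq_of_mem_range_of_dvd_mul_sub (hp.isCoprime_pow_of_not_dvd (hcop i) (s + 1))
      (Finset.mem_filter.1 hj).1 (Finset.mem_filter.1 hj').1 ?_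
    obtain ⟨k, hk⟩ := dvd_sub h h'
    exact ⟨k, by linear_combination hk⟩
  · rintro j - i - ⟨k, hk⟩
    have hms' : ((p ^ s : ℕ) : ℂ) ≠ 0 := by exact_mod_cast hms.ne'
    push_cast at hk
    have hk' := congrArg (Int.cast : ℤ → ℂ) hk
    have hD' := congrArg (Int.cast : ℤ → ℂ) hD
    push_cast at hk' hD'
    refine hf.apply_eq (a := x * t - M * y * z + j * (M * z * t * (1 - p))) (b := k)
      (c := p ^ (s + 1) * (M * z * t * (1 - p)))
      (d := p ^ 2 * t * (x + i * (M * z)) - M * z * (y + i * (p * t)))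
      (n₁ := p * x * (τ : ℂ) + y + j * (p * (M * z * (τ : ℂ) + t)))
      (d₁ := p ^ (s + 1) * (p * (M * z * (τ : ℂ) + t)))
      (n₂ := p * x * (p * (τ : ℂ)) + y + i * (p * (M * z * (p * (τ : ℂ)) + t)))
      (d₂ := (p ^ s : ℕ) * (p * (M * z * (p * (τ : ℂ)) + t))) ?_ ?_
      (mul_ne_zero hms' h0') ?_ ?_ ?_ ?_
    · rw [coe_moebius_translate_div hm, hw, div_add' _ _ _ h0, div_div,
        mul_comm (p * (M * z * (τ : ℂ) + t) : ℂ)]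
      push_cast; rfl
    · rw [coe_moebius_translate_div hms, hw', div_add' _ _ _ h0', div_div, mul_comm (_ * (_ + _))]
    · linear_combination (p * x * t - M * y * z + 1) * hD + M * z * t * (1 - p) * hk
    · push_cast
      exact ⟨p ^ s * (z * t * (1 - p)), by ring⟩
    · push_cast
      linear_combination -(p * x * (τ : ℂ) + y + j * (p * (M * z * (τ : ℂ) + t))) * hD' +
        (M * z * (p * (τ : ℂ)) + t) * hk'
    · push_cast
      linear_combination -(p ^ (s + 1) * (p * (M * z * (τ : ℂ) + t))) * hD'

end

/-- The terms of `f ∣ U_{p^{s+1}} ∣ B_p` with index divisible by `p` are the terms of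
`f ∣ U_{p^s}`. -/
theorem sum_filter_index_dvd_eq {p : ℕ} (hp : 0 < p) (f : UpperHalfPlane → ℂ) (s : ℕ)
    (τ : UpperHalfPlane) :
    ∑ j ∈ range (p ^ (s + 1)) with ((p : ℤ) ∣ (j : ℕ)),
        f (moebius !![1, (j : ℝ); 0, ((p ^ (s + 1) : ℕ) : ℝ)]
          (moebius !![(p : ℝ), 0; 0, 1] τ)) =
      ∑ i ∈ range (p ^ s), f (moebius !![1, (i : ℝ); 0, ((p ^ s : ℕ) : ℝ)] τ) := by
  refine Finset.sum_eq_sum_of_rel (fun j i : ℕ => j = p * i) ?_ ?_ ?_ ?_ ?_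
  · intro j hj
    rw [Finset.mem_filter, Finset.mem_range, Int.natCast_dvd_natCast, pow_succ'] at hj
    obtain ⟨hj, i, rfl⟩ := hj
    exact ⟨i, Finset.mem_range.2 (Nat.lt_of_mul_lt_mul_left hj), rfl⟩
  · intro i hi
    refine ⟨p * i, ?_, rfl⟩
    rw [Finset.mem_filter, Finset.mem_range, Int.natCast_dvd_natCast, pow_succ']
    exact ⟨Nat.mul_lt_mul_of_pos_left (Finset.mem_range.1 hi) hp, dvd_mul_right _ _⟩
  · rintro _ - i - i' - rfl h
    exact Nat.eq_of_mul_eq_mul_left hp h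
  · rintro i - _ - _ - rfl rfl
    rfl
  · rintro _ - i - rfl
    congr 1
    apply UpperHalfPlane.ext
    have hp' : (p : ℂ) ≠ 0 := by exact_mod_cast hp.ne'
    rw [coe_moebius_translate_div (pow_pos hp _), coe_moebius_translate_div (pow_pos hp _),
      coe_moebius_mul hp, pow_succ', ← mul_div_mul_left _ ((p ^ s : ℕ) : ℂ) hp']
    push_cast
    ring

/-- For `p` a prime exactly dividing `N`, `f` weight-`0` invariant under
`Γ₀(N)`, `W_p` an Atkin-Lehner matrix for `p` at level `N`, and any `r ≥ 1`:
`f∣U_{p^r}∣W_p = f∣U_{p^r}∣B_p + (1/p)·f∣U_{p^{r−1}}∣W_p∣B_p − (1/p)·f∣U_{p^{r−1}}`. -/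
theorem Upr_atkinLehner_recursion (N : ℕ) (hN : 0 < N) (p : ℕ) (hp : p.Prime)
    (hpN : p ∣ N) (hpe : ¬ p ∣ N / p)
    (f : UpperHalfPlane → ℂ) (hf : Inv0 N f)
    (W : Matrix (Fin 2) (Fin 2) ℝ) (hW : IsAtkinLehner N p W)
    (r : ℕ) (hr : 1 ≤ r) :
    W0 W (U0 (p ^ r) f) = fun τ =>
      B0 p (U0 (p ^ r) f) τ + (1 / (p : ℂ)) * B0 p (W0 W (U0 (p ^ (r - 1)) f)) τ -
        (1 / (p : ℂ)) * U0 (p ^ (r - 1)) f τ := by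
  obtain ⟨M, rfl⟩ := hpN
  obtain ⟨s, rfl⟩ := Nat.exists_eq_add_of_le' hr
  obtain ⟨x, y, z, t, hD, hact⟩ := hW.exists_entries hp.pos
  funext τ
  have hpB := hact (moebius !![(p : ℝ), 0; 0, 1] τ)
  rw [coe_moebius_mul hp.pos] at hpB
  simp only [W0, B0, U0, Nat.add_sub_cancel]
  rw [← Finset.sum_filter_add_sum_filter_not (range (p ^ (s + 1)))
      (fun j : ℕ => (p : ℤ) ∣ x + (j : ℕ) * (M * z)),
    sum_filter_dvd_eq hp hD hf s (hact τ).2 (hact τ).1 hpB.2 hpB.1,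
    sum_filter_not_dvd_eq hp hD hf s (hact τ).2 (hact τ).1,
    ← Finset.sum_filter_add_sum_filter_not (range (p ^ (s + 1))) (fun j : ℕ => (p : ℤ) ∣ (j : ℕ))
      (fun j : ℕ => f (moebius !![1, (j : ℝ); 0, ((p ^ (s + 1) : ℕ) : ℝ)]
        (moebius !![(p : ℝ), 0; 0, 1] τ))),
    sum_filter_index_dvd_eq hp.pos]
  push_cast
  rw [pow_succ]
  have hp' : (p : ℂ) ≠ 0 := by exact_mod_cast hp.ne_zero
  field_simp
  ring
end
end
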